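/- Let X be a countably infinite set and let E be a dilation (E(Z) ⊇ Z for every finite Z ⊆ X). If the lexicographic composition L_E preserves path independence over the class C^res of responsive choice functions, then E is cardinal: for all finite Z, Z' ⊆ X with Z ∪ E(∅) ≠ X and |Z| = |Z'|, E(Z) = X implies E(Z') = X. -/

import Mathlib

/-! Common definitions: choice functions on a countably infinite set of items,
lexicographic composition subject to an exclusion function, and the various
properties from the paper. Items form a type `X`; finite subsets of `X` are
`Finset X`; set functions are maps `Finset X → Set X`. -/

open scoped Classical

variable {X : Type*}

/-- A choice function selects a subset of its input. -/
def IsChoice (C : Finset X → Finset X) : Prop := ∀ Y, C Y ⊆ Y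

/-- Lexicographic composition of `C1` and `C2` subject to the exclusion
function `E`:  `Y ↦ C1(Y) ∪ C2(Y \ E(C1(Y)))`. -/
noncomputable def lexComp (E : Finset X → Set X) (C1 C2 : Finset X → Finset X) :
    Finset X → Finset X :=
  fun Y => C1 Y ∪ C2 (Y.filter (fun y => y ∉ E (C1 Y)))

/-- Path independence: `C(Y ∪ Y') = C(C(Y) ∪ C(Y'))`. -/
def PathIndependent (C : Finset X → Finset X) : Prop :=
  ∀ Y Y' : Finset X, C (Y ∪ Y') = C (C Y ∪ C Y')

/-- Substitutes: the rejection function is monotone. -/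
def Substitutes (C : Finset X → Finset X) : Prop :=
  ∀ Y Y' : Finset X, Y ⊆ Y' → Y \ C Y ⊆ Y' \ C Y'

/-- Size monotonicity (law of aggregate demand). -/
def SizeMonotonic (C : Finset X → Finset X) : Prop :=
  ∀ Y Y' : Finset X, Y ⊆ Y' → (C Y).card ≤ (C Y').card

/-- Consistency: `C(Y') ⊆ Y ⊆ Y'` implies `C(Y) = C(Y')`. -/
def Consistent (C : Finset X → Finset X) : Prop :=
  ∀ Y Y' : Finset X, C Y' ⊆ Y → Y ⊆ Y' → C Y = C Y'

/-- The `q` highest-ranked acceptable elements of `Y`, with respect to a linear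
order `r` on `X ∪ {∅}` (modelled as `Option X`, `none` playing the role of the
outside option `∅`): `y` is chosen iff `y ≻ ∅` and fewer than `q` acceptable
elements of `Y` are ranked strictly above `y`. -/
noncomputable def topChoice (r : LinearOrder (Option X)) (q : ℕ) (Y : Finset X) : Finset X :=
  Y.filter (fun y => r.lt none (some y) ∧
    (Y.filter (fun z => r.lt none (some z) ∧ r.lt (some y) (some z))).card < q)

/-- `C` is responsive to the linear order `r` on `X ∪ {∅}` and quota `q`. -/
def ResponsiveWith (r : LinearOrder (Option X)) (q : ℕ) (C : Finset X → Finset X) : Prop :=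
  ∀ Y : Finset X, C Y = topChoice r q Y

/-- Responsive choice functions (the class `C^res`). -/
def Responsive (C : Finset X → Finset X) : Prop :=
  ∃ (r : LinearOrder (Option X)) (q : ℕ), ResponsiveWith r q C

/-- Single-valued responsive choice functions (the class `C^{sv-res}`): quota 1. -/
def SVResponsive (C : Finset X → Finset X) : Prop :=
  ∃ r : LinearOrder (Option X), ResponsiveWith r 1 C

/-- `E` is threshold-linear with cardinal reuse with respect to the parameters
`t ∈ ℕ ∪ {0,∞}`, `K ⊆ X` and the chain `∅ = T^0 ⊆ T^1 ⊆ ⋯ ⊆ T^t ⊆ X \ K`: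
for every finite `Z`, if `|Z| < t` then `E(Z) = (Z \ T^{|Z|}) ∪ K`, and
otherwise `G_E(Z) = E(Z) ∪ Z = X`. -/
def TLCRWith (E : Finset X → Set X) (t : ℕ∞) (K : Set X) (T : ℕ → Set X) : Prop :=
  T 0 = ∅ ∧ (∀ n : ℕ, (n : ℕ∞) < t → T n ⊆ T (n + 1)) ∧
  (∀ n : ℕ, (n : ℕ∞) ≤ t → T n ⊆ Kᶜ) ∧
  ∀ Z : Finset X,
    ((Z.card : ℕ∞) < t → E Z = ((Z : Set X) \ T Z.card) ∪ K) ∧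
    (¬ (Z.card : ℕ∞) < t → E Z ∪ (Z : Set X) = Set.univ)

/-- `E` is threshold-linear with cardinal reuse (for some parameters). -/
def TLCR (E : Finset X → Set X) : Prop :=
  ∃ (t : ℕ∞) (K : Set X) (T : ℕ → Set X), TLCRWith E t K T

/-- A dilation `D` is threshold-linear (with threshold `t`), where `K = D(∅)`:
`D(Z) = Z ∪ K` when `|Z| < t`, and `D(Z) = X` otherwise. -/
def ThresholdLinear (D : Finset X → Set X) : Prop :=
  ∃ t : ℕ∞, ∀ Z : Finset X,
    ((Z.card : ℕ∞) < t → D Z = (Z : Set X) ∪ D ∅) ∧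
    (¬ (Z.card : ℕ∞) < t → D Z = Set.univ)

/-- A set function `F` (valued inside its argument) is cardinal-linear:
there is a weakly increasing sequence `∅ = T^0 ⊆ T^1 ⊆ ⋯` with
`F(Z) = Z ∩ T^{|Z|}` for every finite `Z`. -/
def CardinalLinear (F : Finset X → Set X) : Prop :=
  ∃ T : ℕ → Set X, T 0 = ∅ ∧ Monotone T ∧
    ∀ Z : Finset X, F Z = (Z : Set X) ∩ T Z.card

section Equiv

variable (s : Setoid X)

/-- A finite set is feasible if it contains at most one element of each
equivalence class. -/
def Feasible (Z : Finset X) : Prop :=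
  ∀ x ∈ Z, ∀ z ∈ Z, x ≠ z → ¬ s.r x z

/-- A choice function is many-to-one if it always selects a feasible set. -/
def ManyToOne (C : Finset X → Finset X) : Prop :=
  ∀ Y : Finset X, Feasible s (C Y)

/-- `I_Z`: the union of the equivalence classes of the members of `Z`. -/
def IClass (Z : Finset X) : Set X := {y | ∃ x ∈ Z, s.r y x}

/-- `E` is equivalence-excluding: `Z ∪ E(Z) ⊇ I_Z` for every feasible `Z`. -/
def EquivExcluding (E : Finset X → Set X) : Prop :=
  ∀ Z : Finset X, Feasible s Z → IClass s Z ⊆ (Z : Set X) ∪ E Z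

/-- `Cbar` completes `C`: whenever `Cbar(Y)` is feasible, `Cbar(Y) = C(Y)`. -/
def Completes (Cbar C : Finset X → Finset X) : Prop :=
  ∀ Y : Finset X, Feasible s (Cbar Y) → Cbar Y = C Y

/-- `E` is many-to-one threshold-linear with cardinal reuse with the parameters
`t`, `K`, `{T^n}`: the displayed condition holds for every *feasible* `Z`:
if `Z ∪ K ≠ X` and `|Z| < t` then `E(Z) = (Z \ T^{|Z|}) ∪ K`, and otherwise
`G_E(Z) = X`. -/
def MtoTLCRWith (E : Finset X → Set X) (t : ℕ∞) (K : Set X) (T : ℕ → Set X) : Prop :=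
  T 0 = ∅ ∧ (∀ n : ℕ, (n : ℕ∞) < t → T n ⊆ T (n + 1)) ∧
  (∀ n : ℕ, (n : ℕ∞) ≤ t → T n ⊆ Kᶜ) ∧
  ∀ Z : Finset X, Feasible s Z →
    (((Z : Set X) ∪ K ≠ Set.univ ∧ (Z.card : ℕ∞) < t) →
      E Z = ((Z : Set X) \ T Z.card) ∪ K) ∧
    (¬ ((Z : Set X) ∪ K ≠ Set.univ ∧ (Z.card : ℕ∞) < t) →
      E Z ∪ (Z : Set X) = Set.univ)

end Equiv
theorem exists_res {X : Type*} [Countable X] (S T : Finset X) (q : ℕ) :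
    ∃ C : Finset X → Finset X, IsChoice C ∧ Responsive C ∧
      (∀ Y : Finset X, (Y ∩ (S ∪ T)).card ≤ q → C Y = Y ∩ (S ∪ T)) ∧
      (∀ Y : Finset X, (Y ∩ S).card = q → C Y = Y ∩ S) := by
  obtain ⟨e, he⟩ := exists_injective_nat X
  let lev : X → ℤ := fun x => if x ∈ S then 2 else if x ∈ T then 1 else -1
  let f : Option X → Lex (ℤ × ℕ) := fun o =>
    match o with
    | none => toLex (0, 0)
    | some x => toLex (lev x, e x)
  have levne : ∀ x, lev x ≠ 0 := by
    intro x; simp only [lev]; split_ifs <;> norm_num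
  have hf : Function.Injective f := by
    intro a b hab
    rcases a with _ | a <;> rcases b with _ | b
    · rfl
    · have h := congrArg (fun p => (ofLex p).1) hab
      exact absurd h.symm (levne b)
    · have h := congrArg (fun p => (ofLex p).1) hab
      exact absurd h (levne a)
    · have h := congrArg (fun p => (ofLex p).2) hab
      exact congrArg some (he h)
  let r : LinearOrder (Option X) := LinearOrder.lift' f hf
  have hlt : ∀ a b, r.lt a b ↔ f a < f b := fun a b => Iff.rfl
  have hacc : ∀ x, r.lt none (some x) ↔ x ∈ S ∪ T := by
    intro x
    rw [hlt, Prod.Lex.lt_iff]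
    simp only [f, lev, ofLex_toLex, Finset.mem_union]
    by_cases h1 : x ∈ S <;> by_cases h2 : x ∈ T <;> simp [h1, h2]
  have habv : ∀ x y, x ∈ S → y ∉ S → r.lt (some y) (some x) := by
    intro x y hx hy
    rw [hlt, Prod.Lex.lt_iff]
    left
    simp only [f, lev, ofLex_toLex, hx, hy, if_true, if_false]
    split_ifs <;> norm_num
  have hasym : ∀ x y, r.lt (some x) (some y) → ¬ r.lt (some y) (some x) := by
    intro x y h1 h2
    rw [hlt] at h1 h2
    exact lt_asymm h1 h2
  have hirr : ∀ x, ¬ r.lt (some x) (some x) := fun x h => hasym x x h h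
  refine ⟨topChoice r q, fun Y => Finset.filter_subset _ _, ⟨r, q, fun Y => rfl⟩, ?_, ?_⟩
  · intro Y hY
    ext y
    simp only [topChoice, Finset.mem_filter, Finset.mem_inter, hacc]
    constructor
    · rintro ⟨h1, h2, _⟩; exact ⟨h1, h2⟩
    · rintro ⟨h1, h2⟩
      refine ⟨h1, h2, lt_of_lt_of_le (Finset.card_lt_card ?_) hY⟩
      refine (Finset.ssubset_iff_of_subset ?_).2 ⟨y, Finset.mem_inter.2 ⟨h1, h2⟩, ?_⟩
      · intro z hz
        rw [Finset.mem_filter] at hz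
        exact Finset.mem_inter.2 ⟨hz.1, hz.2.1⟩
      · intro hz
        rw [Finset.mem_filter] at hz
        exact hirr y hz.2.2
  · intro Y hY
    ext y
    simp only [topChoice, Finset.mem_filter, Finset.mem_inter, hacc]
    constructor
    · rintro ⟨h1, h2, h3⟩
      refine ⟨h1, ?_⟩
      by_contra hy
      rw [← hY] at h3
      refine absurd (Finset.card_le_card ?_) (not_le.2 h3)
      intro z hz
      rw [Finset.mem_inter] at hz
      exact Finset.mem_filter.2 ⟨hz.1, Finset.mem_union_left _ hz.2, habv z y hz.2 hy⟩
    · rintro ⟨h1, h2⟩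
      refine ⟨h1, Finset.mem_union_left _ h2, ?_⟩
      rw [← hY]
      refine Finset.card_lt_card ?_
      refine (Finset.ssubset_iff_of_subset ?_).2 ⟨y, Finset.mem_inter.2 ⟨h1, h2⟩, ?_⟩
      · intro z hz
        rw [Finset.mem_filter] at hz
        refine Finset.mem_inter.2 ⟨hz.1, ?_⟩
        by_contra hzS
        exact hasym _ _ hz.2.2 (habv y z h2 hzS)
      · intro hz
        rw [Finset.mem_filter] at hz
        exact hirr y hz.2.2

theorem lex_subst {X : Type*} (E : Finset X → Set X) {C1 C2 : Finset X → Finset X}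
    (h1 : IsChoice C1) (h2 : IsChoice C2) (hp : PathIndependent (lexComp E C1 C2))
    {Y Y' : Finset X} (hY : Y ⊆ Y') {x : X} (hx : x ∈ Y) (hx' : x ∈ lexComp E C1 C2 Y') :
    x ∈ lexComp E C1 C2 Y := by
  have hch : ∀ Y, lexComp E C1 C2 Y ⊆ Y := by
    intro Y z hz
    rcases Finset.mem_union.1 hz with h | h
    · exact h1 _ h
    · exact (Finset.mem_filter.1 (h2 _ h)).1
  have h := hp Y (Y' \ Y)
  rw [Finset.union_sdiff_of_subset hY] at h
  rw [h] at hx'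
  rcases Finset.mem_union.1 (hch _ hx') with h' | h'
  · exact h'
  · exact absurd hx (Finset.mem_sdiff.1 (hch _ h')).2

section Main

variable {X : Type*} [Countable X] (E : Finset X → Set X)

theorem E_mono
    (hdil : ∀ Z : Finset X, (Z : Set X) ⊆ E Z)
    (hpres : ∀ C1 C2 : Finset X → Finset X, IsChoice C1 → IsChoice C2 →
      Responsive C1 → Responsive C2 → PathIndependent (lexComp E C1 C2))
    (Z Z' : Finset X) (h : Z ⊆ Z') : E Z ⊆ E Z' := by
  intro x hx
  by_contra hx'
  have hxZ' : x ∉ Z' := fun h => hx' (hdil Z' h)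
  have hxZ : x ∉ Z := fun h' => hxZ' (h h')
  obtain ⟨C1, c1, r1, p1, -⟩ := exists_res Z' ∅ Z'.card
  obtain ⟨C2, c2, r2, p2, -⟩ := exists_res {x} ∅ 1
  have e1 : C1 (insert x Z) = Z := by
    rw [p1 _ (Finset.card_le_card (by simp))]
    ext y; simp only [Finset.mem_inter, Finset.mem_insert, Finset.union_empty]
    constructor
    · rintro ⟨rfl | h1, h2⟩
      · exact absurd h2 hxZ'
      · exact h1
    · intro h1; exact ⟨Or.inr h1, h h1⟩
  have e2 : C1 (insert x Z') = Z' := by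
    rw [p1 _ (Finset.card_le_card (by simp))]
    simp
  have key := lex_subst E c1 c2 (hpres C1 C2 c1 c2 r1 r2)
    (Finset.insert_subset_insert x h) (Finset.mem_insert_self x Z) (by
      rw [lexComp, e2, p2 _ (le_trans (Finset.card_le_card Finset.inter_subset_right) (by simp))]
      simp [hx'])
  rw [lexComp, e1] at key
  rcases Finset.mem_union.1 key with h' | h'
  · exact hxZ h'
  · exact (Finset.mem_filter.1 (c2 _ h')).2 hx

theorem E_swap
    (hdil : ∀ Z : Finset X, (Z : Set X) ⊆ E Z)
    (hpres : ∀ C1 C2 : Finset X → Finset X, IsChoice C1 → IsChoice C2 →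
      Responsive C1 → Responsive C2 → PathIndependent (lexComp E C1 C2))
    (A : Finset X) (a b x : X) (ha : a ∉ A) (hb : b ∉ A) (hab : a ≠ b)
    (hE : E (insert a A) = Set.univ) (hxa : x ≠ a) : x ∈ E (insert b A) := by
  by_contra hx
  have hxZ : x ∉ insert b A := fun h => hx (hdil _ (Finset.mem_coe.2 h))
  rw [Finset.mem_insert, not_or] at hxZ
  obtain ⟨hxb, hxA⟩ := hxZ
  obtain ⟨C1, c1, r1, p1, q1⟩ := exists_res (insert b A) {a} (A.card + 1)
  obtain ⟨C2, c2, r2, p2, -⟩ := exists_res {x} ∅ 1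
  have i1 : insert x (insert a A) ∩ (insert b A ∪ {a}) = insert a A := by
    ext y; simp only [Finset.mem_inter, Finset.mem_insert, Finset.mem_union, Finset.mem_singleton]
    grind
  have i2 : insert x (insert a (insert b A)) ∩ insert b A = insert b A := by
    ext y; simp only [Finset.mem_inter, Finset.mem_insert]
    grind
  have e1 : C1 (insert x (insert a A)) = insert a A := by
    rw [p1 _ (by rw [i1, Finset.card_insert_of_notMem ha]), i1]
  have e2 : C1 (insert x (insert a (insert b A))) = insert b A := by
    rw [q1 _ (by rw [i2, Finset.card_insert_of_notMem hb]), i2]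
  have key := lex_subst E c1 c2 (hpres C1 C2 c1 c2 r1 r2)
    (Finset.insert_subset_insert x (Finset.insert_subset_insert a (Finset.subset_insert b A)))
    (Finset.mem_insert_self x _) (by
      rw [lexComp, e2, p2 _ (le_trans (Finset.card_le_card Finset.inter_subset_right) (by simp))]
      simp [hx])
  rw [lexComp, e1] at key
  rcases Finset.mem_union.1 key with h' | h'
  · rcases Finset.mem_insert.1 h' with h | h
    · exact hxa h
    · exact hxA h
  · exact (Finset.mem_filter.1 (c2 _ h')).2 (by rw [hE]; trivial)

theorem E_last
    (hdil : ∀ Z : Finset X, (Z : Set X) ⊆ E Z)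
    (hpres : ∀ C1 C2 : Finset X → Finset X, IsChoice C1 → IsChoice C2 →
      Responsive C1 → Responsive C2 → PathIndependent (lexComp E C1 C2))
    (W : Finset X) (a c : X) (hac : a ≠ c) (hcW : c ∉ W) (hcK : c ∉ E ∅)
    (hcE : c ∈ E W) : a ∈ E W := by
  by_contra ha
  have haW : a ∉ W := fun h => ha (hdil _ (Finset.mem_coe.2 h))
  have haK : a ∉ E ∅ := fun h => ha (E_mono E hdil hpres _ _ (Finset.empty_subset W) h)
  obtain ⟨C1, c1, r1, p1, -⟩ := exists_res W ∅ W.card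
  obtain ⟨C2, c2, r2, p2, q2⟩ := exists_res {c} {a} 1
  have e1 : C1 {c, a} = ∅ := by
    have : ({c, a} : Finset X) ∩ (W ∪ ∅) = ∅ := by
      ext y; simp only [Finset.mem_inter, Finset.mem_insert, Finset.mem_singleton,
        Finset.union_empty]
      grind
    rw [p1 _ (by rw [this]; simp), this]
  have e2 : C1 ({c, a} ∪ W) = W := by
    have : ({c, a} ∪ W) ∩ (W ∪ ∅) = W := by
      ext y; simp
      tauto
    rw [p1 _ (by rw [this]), this]
  have key := lex_subst E c1 c2 (hpres C1 C2 c1 c2 r1 r2)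
    (Y := {c, a}) (Y' := {c, a} ∪ W) (x := a) Finset.subset_union_left (by simp) (by
      rw [lexComp, e2]
      have : (({c, a} ∪ W).filter (fun y => y ∉ E W)) ∩ ({c} ∪ {a}) = {a} := by
        ext y; simp only [Finset.mem_inter, Finset.mem_filter, Finset.mem_union,
          Finset.mem_insert, Finset.mem_singleton]
        grind
      rw [p2 _ (by rw [this]; simp), this]
      simp)
  rw [lexComp, e1] at key
  have i : (({c, a} : Finset X).filter (fun y => y ∉ E ∅)) ∩ {c} = {c} := by
    ext y; simp only [Finset.mem_inter, Finset.mem_filter,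
      Finset.mem_insert, Finset.mem_singleton]
    grind
  rw [q2 _ (by rw [i]; simp), i] at key
  simp at key
  exact hac key

theorem E_swap_full [Infinite X]
    (hdil : ∀ Z : Finset X, (Z : Set X) ⊆ E Z)
    (hpres : ∀ C1 C2 : Finset X → Finset X, IsChoice C1 → IsChoice C2 →
      Responsive C1 → Responsive C2 → PathIndependent (lexComp E C1 C2))
    (A : Finset X) (a b c : X) (ha : a ∉ A) (hb : b ∉ A) (hab : a ≠ b)
    (hcA : c ∉ A) (hca : c ≠ a) (hcK : c ∉ E ∅)
    (hE : E (insert a A) = Set.univ) : E (insert b A) = Set.univ := by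
  rw [Set.eq_univ_iff_forall]
  intro x
  by_cases hxa : x = a
  swap
  · exact E_swap E hdil hpres A a b x ha hb hab hE hxa
  subst hxa
  obtain ⟨d, hd⟩ := Infinite.exists_notMem_finset (A ∪ {x, b, c})
  simp only [Finset.mem_union, Finset.mem_insert, Finset.mem_singleton, not_or] at hd
  obtain ⟨hdA, hdx, hdb, hdc⟩ := hd
  have hsub : ∀ y, y ≠ x → y ∈ E (insert d A) := fun y hy =>
    E_swap E hdil hpres A x d y ha hdA (Ne.symm hdx) hE hy
  have hx : x ∈ E (insert d A) := by
    refine E_last E hdil hpres (insert d A) x c (Ne.symm hca) ?_ hcK (hsub c hca)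
    rw [Finset.mem_insert, not_or]
    exact ⟨fun h => hdc h.symm, hcA⟩
  have hfull : E (insert d A) = Set.univ := by
    rw [Set.eq_univ_iff_forall]
    intro y
    by_cases hy : y = x
    · rw [hy]; exact hx
    · exact hsub y hy
  exact E_swap E hdil hpres A d b x hdA hb hdb hfull (Ne.symm hdx)

theorem E_card [Infinite X]
    (hdil : ∀ Z : Finset X, (Z : Set X) ⊆ E Z)
    (hpres : ∀ C1 C2 : Finset X → Finset X, IsChoice C1 → IsChoice C2 →
      Responsive C1 → Responsive C2 → PathIndependent (lexComp E C1 C2))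
    (c : X) (hcK : c ∉ E ∅) (Z' : Finset X) (m : ℕ) :
    ∀ Z : Finset X, (Z' \ Z).card = m → Z.card = Z'.card → c ∉ Z →
      E Z = Set.univ → E Z' = Set.univ := by
  induction m with
  | zero =>
    intro Z hm hc _ hE
    rw [Finset.card_eq_zero, Finset.sdiff_eq_empty_iff_subset] at hm
    rw [Finset.eq_of_subset_of_card_le hm hc.le]
    exact hE
  | succ m ih =>
    intro Z hm hc hcZ hE
    have hm2 : (Z \ Z').card = m + 1 := by
      rw [← hm]
      exact Finset.card_sdiff_comm hc
    obtain ⟨a, ha⟩ := Finset.card_pos.1 (by omega : 0 < (Z \ Z').card)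
    rw [Finset.mem_sdiff] at ha
    obtain ⟨haZ, haZ'⟩ := ha
    have hca : c ≠ a := fun h => hcZ (h ▸ haZ)
    have hinsA : insert a (Z.erase a) = Z := Finset.insert_erase haZ
    have step : ∀ b, b ∈ Z' \ Z → E (insert b (Z.erase a)) = Set.univ ∧
        (Z' \ insert b (Z.erase a)).card = m ∧ (insert b (Z.erase a)).card = Z'.card := by
      intro b hb
      have hb' := hb
      rw [Finset.mem_sdiff] at hb
      have hbA : b ∉ Z.erase a := fun h => hb.2 (Finset.mem_of_mem_erase h)
      refine ⟨E_swap_full E hdil hpres (Z.erase a) a b c (Finset.notMem_erase a Z)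
        hbA (fun h => hb.2 (h ▸ haZ))
        (fun h => hcZ (Finset.mem_of_mem_erase h)) hca hcK (by rw [hinsA]; exact hE), ?_, ?_⟩
      · have : Z' \ insert b (Z.erase a) = (Z' \ Z).erase b := by
          ext y; simp only [Finset.mem_sdiff, Finset.mem_insert, Finset.mem_erase]
          grind
        rw [this, Finset.card_erase_of_mem hb', hm]; rfl
      · rw [Finset.card_insert_of_notMem hbA, Finset.card_erase_of_mem haZ]
        have := Finset.card_pos.2 ⟨a, haZ⟩
        omega
    by_cases hex : ∃ b ∈ Z' \ Z, b ≠ c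
    · obtain ⟨b, hb, hbc⟩ := hex
      obtain ⟨s1, s2, s3⟩ := step b hb
      refine ih _ s2 s3 ?_ s1
      rw [Finset.mem_insert, not_or]
      exact ⟨fun h => hbc h.symm, fun h => hcZ (Finset.mem_of_mem_erase h)⟩
    · push Not at hex
      obtain ⟨b, hb⟩ := Finset.card_pos.1 (by omega : 0 < (Z' \ Z).card)
      obtain ⟨s1, s2, s3⟩ := step b hb
      have hsub : Z' ⊆ insert b (Z.erase a) := by
        intro y hy
        by_cases hyZ : y ∈ Z
        · refine Finset.mem_insert_of_mem (Finset.mem_erase.2 ⟨fun h => haZ' (h ▸ hy), hyZ⟩)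
        · have h1 := hex y (Finset.mem_sdiff.2 ⟨hy, hyZ⟩)
          rw [h1, ← hex b hb]
          exact Finset.mem_insert_self _ _
      rw [Finset.eq_of_subset_of_card_le hsub s3.le]
      exact s1

end Main

/-- **Claim (dilations are cardinal).** If `E` is a dilation and `L_E`
preserves path independence over responsive choice functions, then `E` is
cardinal: for finite `Z, Z'` with `Z ∪ E(∅) ≠ X` and `|Z| = |Z'|`,
`E(Z) = X` implies `E(Z') = X`. -/
theorem dilation_preserving_pi_cardinal
    {X : Type*} [Countable X] [Infinite X] (E : Finset X → Set X)
    (hdil : ∀ Z : Finset X, (Z : Set X) ⊆ E Z)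
    (hpres : ∀ C1 C2 : Finset X → Finset X, IsChoice C1 → IsChoice C2 →
      Responsive C1 → Responsive C2 → PathIndependent (lexComp E C1 C2)) :
    ∀ Z Z' : Finset X, (Z : Set X) ∪ E ∅ ≠ Set.univ → Z.card = Z'.card →
      E Z = Set.univ → E Z' = Set.univ := by
  intro Z Z' hne hcard hE
  obtain ⟨c, hc⟩ := (Set.ne_univ_iff_exists_notMem _).1 hne
  rw [Set.mem_union, not_or] at hc
  exact E_card E hdil hpres c hc.2 Z' _ Z rfl hcard (fun h => hc.1 (Finset.mem_coe.2 h)) hE
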